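/- arXiv:2402.01779 — 2 statements merged into one kernel-verified Lean document; each statement's English description precedes it below -/
import Mathlib

section
/- If the prior p is the Gaussian density N(μ, Σ) on R^d, then the SNORE regularization R_σ(x) = -E_{x̃ ~ N(x, σ²I)}[log p_σ(x̃)] equals σ² Tr((Σ + σ²I)^{-1}) + (1/2)(x - μ)ᵀ(Σ + σ²I)^{-1}(x - μ) up to an additive constant independent of x, and consequently ∇R_σ(x) = (Σ + σ²I)^{-1}(x - μ) = -∇ log p_σ(x). -/
open MeasureTheory Real

/-- The isotropic Gaussian density `N(0, σ²I_d)` on `ℝ^d`. -/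
noncomputable def gaussDensity (d : ℕ) (σ : ℝ) (x : EuclideanSpace ℝ (Fin d)) : ℝ :=
  (2 * π * σ ^ 2) ^ (-(d : ℝ) / 2) * Real.exp (-‖x‖ ^ 2 / (2 * σ ^ 2))

/-- Multivariate Gaussian density `N(x; μ, Σ)`. -/
noncomputable def gaussM {d : ℕ} (S : Matrix (Fin d) (Fin d) ℝ)
    (μ x : EuclideanSpace ℝ (Fin d)) : ℝ :=
  (Real.sqrt ((2 * π) ^ d * S.det))⁻¹ *
    Real.exp (-(1 / 2) * ∑ i, ∑ j, (x - μ) i * S⁻¹ i j * (x - μ) j)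

/-- Matrix applied to a Euclidean vector. -/
noncomputable def mulVecE {d : ℕ} (A : Matrix (Fin d) (Fin d) ℝ)
    (v : EuclideanSpace ℝ (Fin d)) : EuclideanSpace ℝ (Fin d) :=
  (EuclideanSpace.equiv (Fin d) ℝ).symm (A.mulVec ((EuclideanSpace.equiv (Fin d) ℝ) v))

/-- A Gaussian factor times an integrand of at most quadratic growth is integrable. -/
lemma integrable_gaussian_mul_of_abs_le {E : Type*} [NormedAddCommGroup E]
    [InnerProductSpace ℝ E] [FiniteDimensional ℝ E] [MeasurableSpace E] [BorelSpace E]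
    {b : ℝ} (hb : 0 < b) {f : E → ℝ} (hf : Continuous f) {C : ℝ}
    (hC : ∀ z, |f z| ≤ C * (1 + ‖z‖ ^ 2)) :
    Integrable (fun z : E => Real.exp (-b * ‖z‖ ^ 2) * f z) := by
  have hexp_int : Integrable (fun z : E => Real.exp (-(b / 2) * ‖z‖ ^ 2)) := by
    have h := GaussianFourier.integral_rexp_neg_mul_sq_norm (V := E) (half_pos hb)
    by_contra hn
    rw [integral_undef hn] at h
    have : 0 < (π / (b / 2)) ^ (Module.finrank ℝ E / 2 : ℝ) := by positivity
    exact this.ne h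
  have hC0 : 0 ≤ C := by
    have h := (abs_nonneg _).trans (hC 0)
    simpa using h
  refine (hexp_int.const_mul (C * (1 + 2 / b))).mono' (by fun_prop) (ae_of_all _ fun z => ?_)
  have hle : 1 + ‖z‖ ^ 2 ≤ (1 + 2 / b) * Real.exp (b / 2 * ‖z‖ ^ 2) := by
    have h1 := Real.add_one_le_exp (b / 2 * ‖z‖ ^ 2)
    have h2 : ‖z‖ ^ 2 = 2 / b * (b / 2 * ‖z‖ ^ 2) := by field_simp
    have h3 : 0 ≤ b / 2 * ‖z‖ ^ 2 := by positivity
    have h4 : 0 < 2 / b := by positivity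
    nlinarith [mul_le_mul_of_nonneg_left h1 h4.le]
  rw [Real.norm_eq_abs, abs_mul, Real.abs_exp]
  calc Real.exp (-b * ‖z‖ ^ 2) * |f z|
      ≤ Real.exp (-b * ‖z‖ ^ 2) * (C * ((1 + 2 / b) * Real.exp (b / 2 * ‖z‖ ^ 2))) := by
        gcongr
        exact (hC z).trans (by gcongr)
    _ = C * (1 + 2 / b) * (Real.exp (-b * ‖z‖ ^ 2) * Real.exp (b / 2 * ‖z‖ ^ 2)) := by ring
    _ = C * (1 + 2 / b) * Real.exp (-(b / 2) * ‖z‖ ^ 2) := by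
        rw [← Real.exp_add]; ring_nf

lemma gaussDensity_eq {d : ℕ} (σ : ℝ) (z : EuclideanSpace ℝ (Fin d)) :
    gaussDensity d σ z =
      (2 * π * σ ^ 2) ^ (-(d : ℝ) / 2) * Real.exp (-(1 / (2 * σ ^ 2)) * ‖z‖ ^ 2) := by
  rw [gaussDensity]; congr 2; ring

lemma gaussDensity_neg {d : ℕ} (σ : ℝ) (z : EuclideanSpace ℝ (Fin d)) :
    gaussDensity d σ (-z) = gaussDensity d σ z := by
  simp [gaussDensity]

lemma integrable_gaussDensity_mul_of_abs_le {d : ℕ} {σ : ℝ} (hσ : 0 < σ)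
    {f : EuclideanSpace ℝ (Fin d) → ℝ} (hf : Continuous f) {C : ℝ}
    (hC : ∀ z, |f z| ≤ C * (1 + ‖z‖ ^ 2)) :
    Integrable (fun z => gaussDensity d σ z * f z) := by
  simp_rw [gaussDensity_eq, mul_assoc]
  exact (integrable_gaussian_mul_of_abs_le (by positivity) hf hC).const_mul _

lemma integral_gaussDensity {d : ℕ} {σ : ℝ} (hσ : 0 < σ) :
    ∫ z, gaussDensity d σ z = 1 := by
  simp_rw [gaussDensity_eq]
  rw [integral_const_mul, GaussianFourier.integral_rexp_neg_mul_sq_norm (by positivity),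
    finrank_euclideanSpace_fin, show π / (1 / (2 * σ ^ 2)) = 2 * π * σ ^ 2 by field_simp,
    ← Real.rpow_add (by positivity)]
  ring_nf
  simp

/-- The expectation of a quadratic form under an isotropic Gaussian, up to its value at the
centre. -/
lemma integral_gaussDensity_mul_quadratic {d : ℕ} {σ : ℝ} (hσ : 0 < σ)
    {L : EuclideanSpace ℝ (Fin d) →L[ℝ] EuclideanSpace ℝ (Fin d)}
    (hL : ∀ v w, inner ℝ (L v) w = inner ℝ v (L w)) (v : EuclideanSpace ℝ (Fin d)) (C : ℝ) :
    ∫ z, gaussDensity d σ z * (C - 1 / 2 * inner ℝ (z + v) (L (z + v))) =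
      C - 1 / 2 * (∫ z, gaussDensity d σ z * inner ℝ z (L z)) - 1 / 2 * inner ℝ v (L v) := by
  have h1 : Integrable (gaussDensity d σ) := by
    simpa using integrable_gaussDensity_mul_of_abs_le (d := d) hσ
      (continuous_const (y := (1 : ℝ))) (C := 1) (fun z => by simp)
  have h2 : Integrable (fun z => gaussDensity d σ z * inner ℝ z (L z)) := by
    refine integrable_gaussDensity_mul_of_abs_le hσ (by fun_prop) (C := ‖L‖) fun z => ?_
    calc |inner ℝ z (L z)| ≤ ‖z‖ * ‖L z‖ := abs_real_inner_le_norm _ _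
      _ ≤ ‖z‖ * (‖L‖ * ‖z‖) := by gcongr; exact L.le_opNorm z
      _ ≤ ‖L‖ * (1 + ‖z‖ ^ 2) := by nlinarith [norm_nonneg L]
  have h3 : Integrable (fun z => gaussDensity d σ z * inner ℝ z (L v)) := by
    refine integrable_gaussDensity_mul_of_abs_le hσ (by fun_prop) (C := ‖L v‖) fun z => ?_
    calc |inner ℝ z (L v)| ≤ ‖z‖ * ‖L v‖ := abs_real_inner_le_norm _ _
      _ ≤ ‖L v‖ * (1 + ‖z‖ ^ 2) := by
        nlinarith [norm_nonneg (L v), mul_nonneg (norm_nonneg (L v)) (sq_nonneg (‖z‖ - 1)),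
          mul_nonneg (norm_nonneg (L v)) (sq_nonneg ‖z‖)]
  have hodd : ∫ z, gaussDensity d σ z * inner ℝ z (L v) = 0 := by
    have h := integral_neg_eq_self (fun z => gaussDensity d σ z * inner ℝ z (L v)) volume
    simp only [gaussDensity_neg, inner_neg_left, mul_neg, integral_neg] at h
    linarith
  have hexp : ∀ z, gaussDensity d σ z * (C - 1 / 2 * inner ℝ (z + v) (L (z + v))) =
      (C - 1 / 2 * inner ℝ v (L v)) * gaussDensity d σ z
        - 1 / 2 * (gaussDensity d σ z * inner ℝ z (L z))
        - gaussDensity d σ z * inner ℝ z (L v) := by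
    intro z
    have hs : inner ℝ v (L z) = inner ℝ z (L v) := by rw [← hL, real_inner_comm]
    simp only [map_add, inner_add_left, inner_add_right, hs]
    ring
  simp_rw [hexp]
  rw [integral_sub (by fun_prop) h3,
    integral_sub (h1.const_mul _) (h2.const_mul _), integral_const_mul, integral_const_mul,
    integral_gaussDensity hσ, hodd]
  ring

lemma hasGradientAt_quadratic {E : Type*} [NormedAddCommGroup E] [InnerProductSpace ℝ E]
    [CompleteSpace E] {L : E →L[ℝ] E} (hL : ∀ v w, inner ℝ (L v) w = inner ℝ v (L w))
    (μ x : E) :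
    HasGradientAt (fun z => 1 / 2 * inner ℝ (z - μ) (L (z - μ))) (L (x - μ)) x := by
  have h0 : HasFDerivAt (fun z : E => z - μ) (ContinuousLinearMap.id ℝ E) x :=
    (hasFDerivAt_id x).sub_const μ
  have h1 := (h0.inner ℝ (L.hasFDerivAt.comp x h0)).const_mul (1 / 2 : ℝ)
  rw [hasGradientAt_iff_hasFDerivAt]
  refine h1.congr_fderiv ?_
  ext w
  have h2 : inner ℝ w (L (x - μ)) = inner ℝ (L (x - μ)) w := real_inner_comm _ _
  have h3 := hL (x - μ) w
  simp [fderivInnerCLM_apply, -map_sub, h2, ← h3]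
  ring

lemma sum_sum_mul_mul_eq_inner {d : ℕ} (A : Matrix (Fin d) (Fin d) ℝ)
    (v : EuclideanSpace ℝ (Fin d)) :
    ∑ i, ∑ j, v i * A i j * v j = inner ℝ v (Matrix.toEuclideanCLM (𝕜 := ℝ) A v) := by
  simp only [PiLp.inner_apply, Matrix.ofLp_toEuclideanCLM, Matrix.mulVec, dotProduct]
  refine Finset.sum_congr rfl fun i _ => ?_
  simp [Finset.mul_sum, mul_comm, mul_assoc, mul_left_comm]

lemma inner_toEuclideanCLM_comm {d : ℕ} {A : Matrix (Fin d) (Fin d) ℝ} (hA : A.IsHermitian)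
    (v w : EuclideanSpace ℝ (Fin d)) :
    inner ℝ (Matrix.toEuclideanCLM (𝕜 := ℝ) A v) w =
      inner ℝ v (Matrix.toEuclideanCLM (𝕜 := ℝ) A w) :=
  Matrix.isSymmetric_toEuclideanLin_iff.mpr hA v w

/-- Completing the square for the convolution of `N(0, S)` with `N(0, σ²I)`; here `u` is the
deviation from the posterior mean `S (S + σ²I)⁻¹ v`. -/
lemma complete_square {d : ℕ} {σ : ℝ} (hσ : 0 < σ) {S : Matrix (Fin d) (Fin d) ℝ}
    (hS : S.PosDef) {T : Matrix (Fin d) (Fin d) ℝ} (hT : T = S + σ ^ 2 • 1)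
    (hTu : IsUnit T.det) (v u : EuclideanSpace ℝ (Fin d)) :
    let m := Matrix.toEuclideanCLM (𝕜 := ℝ) S (Matrix.toEuclideanCLM (𝕜 := ℝ) T⁻¹ v)
    inner ℝ (u + m) (Matrix.toEuclideanCLM (𝕜 := ℝ) S⁻¹ (u + m)) +
        1 / σ ^ 2 * ‖v - (u + m)‖ ^ 2 =
      (inner ℝ u (Matrix.toEuclideanCLM (𝕜 := ℝ) S⁻¹ u) + 1 / σ ^ 2 * ‖u‖ ^ 2) +
        inner ℝ v (Matrix.toEuclideanCLM (𝕜 := ℝ) T⁻¹ v) := by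
  intro m
  set a := Matrix.toEuclideanCLM (𝕜 := ℝ) T⁻¹ v with ha
  have hSu : IsUnit S.det := hS.det_pos.ne'.isUnit
  have hv : v = m + σ ^ 2 • a := by
    have h : Matrix.toEuclideanCLM (𝕜 := ℝ) T a = v := by
      rw [ha, ← mul_apply_eq_comp, ← map_mul, Matrix.mul_nonsing_inv _ hTu]
      simp
    rw [← h, hT]
    simp [m, a]
  have hm : Matrix.toEuclideanCLM (𝕜 := ℝ) S⁻¹ m = a := by
    change Matrix.toEuclideanCLM (𝕜 := ℝ) S⁻¹ (Matrix.toEuclideanCLM (𝕜 := ℝ) S a) = a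
    rw [← mul_apply_eq_comp, ← map_mul, Matrix.nonsing_inv_mul _ hSu]
    simp
  have hcross : inner ℝ m (Matrix.toEuclideanCLM (𝕜 := ℝ) S⁻¹ u) = inner ℝ u a := by
    rw [← inner_toEuclideanCLM_comm hS.isHermitian.inv, hm, real_inner_comm]
  have hsub : v - (u + m) = σ ^ 2 • a - u := by rw [hv]; abel
  have hva : inner ℝ v a = inner ℝ m a + σ ^ 2 * ‖a‖ ^ 2 := by
    rw [hv, inner_add_left, real_inner_smul_left, real_inner_self_eq_norm_sq]
  rw [hsub, norm_sub_sq_real, hva, map_add, inner_add_left, inner_add_right, inner_add_right,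
    hm, hcross, norm_smul, real_inner_smul_left, real_inner_comm a u, Real.norm_eq_abs,
    abs_of_pos (by positivity)]
  field_simp
  ring

lemma gaussM_eq {d : ℕ} (S : Matrix (Fin d) (Fin d) ℝ) (μ x : EuclideanSpace ℝ (Fin d)) :
    gaussM S μ x = (Real.sqrt ((2 * π) ^ d * S.det))⁻¹ *
      Real.exp (-(1 / 2) * inner ℝ (x - μ) (Matrix.toEuclideanCLM (𝕜 := ℝ) S⁻¹ (x - μ))) := by
  rw [gaussM, sum_sum_mul_mul_eq_inner]

/-- The convolution of `N(μ, S)` with `N(0, σ²I)` is proportional to the density of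
`N(μ, S + σ²I)`. -/
lemma exists_integral_gaussM_mul_gaussDensity {d : ℕ} {σ : ℝ} (hσ : 0 < σ)
    (μ : EuclideanSpace ℝ (Fin d)) {S : Matrix (Fin d) (Fin d) ℝ} (hS : S.PosDef)
    {T : Matrix (Fin d) (Fin d) ℝ} (hT : T = S + σ ^ 2 • 1) (hTu : IsUnit T.det) :
    ∃ K : ℝ, 0 < K ∧ ∀ x, ∫ y, gaussM S μ y * gaussDensity d σ (x - y) =
      K * Real.exp (-(1 / 2) *
        inner ℝ (x - μ) (Matrix.toEuclideanCLM (𝕜 := ℝ) T⁻¹ (x - μ))) := by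
  let q : EuclideanSpace ℝ (Fin d) → ℝ := fun u =>
    -(1 / 2) * inner ℝ u (Matrix.toEuclideanCLM (𝕜 := ℝ) S⁻¹ u)
  let c : ℝ := (Real.sqrt ((2 * π) ^ d * S.det))⁻¹ * (2 * π * σ ^ 2) ^ (-(d : ℝ) / 2)
  have hc : 0 < c := by
    have := hS.det_pos
    positivity
  have hq : ∀ u, q u ≤ 0 := by
    intro u
    have h : 0 ≤ inner ℝ u (Matrix.toEuclideanCLM (𝕜 := ℝ) S⁻¹ u) := by
      have h := hS.inv.posSemidef.dotProduct_mulVec_nonneg (u : Fin d → ℝ)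
      rw [← sum_sum_mul_mul_eq_inner]
      simpa [dotProduct, Matrix.mulVec, Finset.mul_sum, mul_assoc] using h
    simp only [q]
    linarith
  have hexp_int : Integrable (fun u => Real.exp (-(1 / (2 * σ ^ 2)) * ‖u‖ ^ 2 + q u)) := by
    simp_rw [Real.exp_add]
    refine integrable_gaussian_mul_of_abs_le (by positivity) (by fun_prop) (C := 1) fun u => ?_
    rw [Real.abs_exp]
    nlinarith [Real.exp_le_one_iff.mpr (hq u), sq_nonneg ‖u‖]
  refine ⟨c * ∫ u, Real.exp (-(1 / (2 * σ ^ 2)) * ‖u‖ ^ 2 + q u),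
    mul_pos hc (integral_exp_pos hexp_int), fun x => ?_⟩
  let m := Matrix.toEuclideanCLM (𝕜 := ℝ) S (Matrix.toEuclideanCLM (𝕜 := ℝ) T⁻¹ (x - μ))
  rw [← integral_add_right_eq_self _ (m + μ), mul_right_comm, ← integral_const_mul]
  refine integral_congr_ae (ae_of_all _ fun u => ?_)
  have hsq := complete_square hσ hS hT hTu (x - μ) u
  simp only at hsq
  have e1 : u + (m + μ) - μ = u + m := by abel
  have e2 : x - (u + (m + μ)) = x - μ - (u + m) := by abel
  simp only [gaussM_eq, gaussDensity_eq, e1, e2]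
  rw [mul_mul_mul_comm, ← Real.exp_add, mul_assoc c, ← Real.exp_add]
  congr 2
  simp only [q]
  linear_combination (-1 / 2) * hsq

/-- For a Gaussian prior `p = N(μ, Σ)`, the SNORE regularization
`R_σ(x) = -E_{x̃ ~ N(x,σ²I)}[log p_σ(x̃)]` equals
`σ² Tr((Σ+σ²I)⁻¹) + ½ (x-μ)ᵀ(Σ+σ²I)⁻¹(x-μ)` up to an additive constant,
and `∇R_σ(x) = (Σ+σ²I)⁻¹(x-μ) = -∇ log p_σ(x)`. -/
theorem stmt3 {d : ℕ} (σ : ℝ) (hσ : 0 < σ) (μ : EuclideanSpace ℝ (Fin d))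
    (S : Matrix (Fin d) (Fin d) ℝ) (hS : S.PosDef)
    (p pσ Rσ : EuclideanSpace ℝ (Fin d) → ℝ)
    (hp : ∀ x, p x = gaussM S μ x)
    (hpσ : ∀ x, pσ x = ∫ y, p y * gaussDensity d σ (x - y))
    (hR : ∀ x, Rσ x = -(∫ z, gaussDensity d σ (z - x) * Real.log (pσ z))) :
    (∃ c : ℝ, ∀ x, Rσ x =
        σ ^ 2 * (S + σ ^ 2 • (1 : Matrix (Fin d) (Fin d) ℝ))⁻¹.trace +
          (1 / 2) * ∑ i, ∑ j, (x - μ) i *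
            (S + σ ^ 2 • (1 : Matrix (Fin d) (Fin d) ℝ))⁻¹ i j * (x - μ) j + c) ∧
    ∀ x, gradient Rσ x =
        mulVecE (S + σ ^ 2 • (1 : Matrix (Fin d) (Fin d) ℝ))⁻¹ (x - μ) ∧
      gradient Rσ x = -gradient (fun z => Real.log (pσ z)) x := by
  set T := S + σ ^ 2 • (1 : Matrix (Fin d) (Fin d) ℝ) with hT
  have hTpos : T.PosDef :=
    hS.add_posSemidef (Matrix.PosSemidef.one.smul (by positivity))
  obtain ⟨K, hK, hconv⟩ := exists_integral_gaussM_mul_gaussDensity hσ μ hS hT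
    hTpos.det_pos.ne'.isUnit
  set L := Matrix.toEuclideanCLM (𝕜 := ℝ) T⁻¹
  have hL : ∀ v w, inner ℝ (L v) w = inner ℝ v (L w) :=
    inner_toEuclideanCLM_comm hTpos.isHermitian.inv
  have hlog : ∀ z, Real.log (pσ z) = Real.log K - 1 / 2 * inner ℝ (z - μ) (L (z - μ)) := by
    intro z
    simp_rw [hpσ, hp, hconv]
    rw [Real.log_mul hK.ne' (Real.exp_ne_zero _), Real.log_exp]
    ring
  have hRσ : ∀ x, Rσ x = 1 / 2 * inner ℝ (x - μ) (L (x - μ)) +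
      (1 / 2 * (∫ z, gaussDensity d σ z * inner ℝ z (L z)) - Real.log K) := by
    intro x
    rw [hR, ← integral_add_right_eq_self _ x]
    simp_rw [hlog, add_sub_cancel_right, add_sub_assoc]
    rw [integral_gaussDensity_mul_quadratic hσ hL]
    ring
  have hgradR : ∀ x, gradient Rσ x = L (x - μ) := by
    intro x
    rw [funext hRσ]
    refine HasGradientAt.gradient ?_
    rw [hasGradientAt_iff_hasFDerivAt]
    exact (hasGradientAt_quadratic hL μ x).hasFDerivAt.add_const _
  have hgradlog : ∀ x, gradient (fun z => Real.log (pσ z)) x = -L (x - μ) := by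
    intro x
    rw [funext hlog]
    refine HasGradientAt.gradient ?_
    rw [hasGradientAt_iff_hasFDerivAt, map_neg]
    exact (hasGradientAt_quadratic hL μ x).hasFDerivAt.const_sub _
  refine ⟨⟨1 / 2 * (∫ z, gaussDensity d σ z * inner ℝ z (L z)) - Real.log K -
    σ ^ 2 * T⁻¹.trace, fun x => ?_⟩, fun x => ⟨hgradR x, ?_⟩⟩
  · rw [hRσ, sum_sum_mul_mul_eq_inner]
    ring
  · rw [hgradR, hgradlog, neg_neg]
end

section
/- Under Assumptions (a) p ∈ C¹(R^d, (0,∞)) with ‖p‖_∞ + ‖∇p‖_∞ < ∞ and ‖∇ log p(x)‖ ≤ A(1 + ‖x‖^q) for all x, and (b) ‖∇ log p_σ(x)‖ ≤ B σ^β (1 + ‖x‖^r) for all x and σ ∈ (0, σ₀], the SNORE score ∇R_σ(x) = -E_{ζ ~ N(0, σ²I)}[∇ log p_σ(x + ζ)] converges uniformly to -∇ log p on every compact subset K of R^d as σ → 0. -/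
open MeasureTheory Real

theorem gaussDensity_one_eq (d : ℕ) (z : EuclideanSpace ℝ (Fin d)) :
    gaussDensity d 1 z = (2 * π) ^ (-(d : ℝ) / 2) * Real.exp (-(1 / 2) * ‖z‖ ^ 2) := by
  unfold gaussDensity
  congr 2 <;> ring

theorem gaussDensity_nonneg (d : ℕ) (σ : ℝ) (z : EuclideanSpace ℝ (Fin d)) :
    0 ≤ gaussDensity d σ z := by
  unfold gaussDensity
  positivity

theorem continuous_gaussDensity (d : ℕ) (σ : ℝ) : Continuous (gaussDensity d σ) := by
  unfold gaussDensity
  fun_prop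

theorem integrable_exp_neg_mul_norm_sq {V : Type*} [NormedAddCommGroup V] [InnerProductSpace ℝ V]
    [FiniteDimensional ℝ V] [MeasurableSpace V] [BorelSpace V] {b : ℝ} (hb : 0 < b) :
    Integrable (fun z : V => Real.exp (-b * ‖z‖ ^ 2)) := by
  have h := (GaussianFourier.integrable_cexp_neg_mul_sq_norm_add (V := V) (b := (b : ℂ))
    (by simpa using hb) 0 0).norm
  refine h.congr (Filter.Eventually.of_forall fun z => ?_)
  simp only [Complex.norm_exp]
  norm_num
  norm_cast
  exact Or.inl rfl

theorem integral_gaussDensity_one (d : ℕ) : ∫ z, gaussDensity d 1 z = 1 := by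
  simp_rw [gaussDensity_one_eq]
  rw [integral_const_mul, GaussianFourier.integral_rexp_neg_mul_sq_norm (by norm_num)]
  rw [finrank_euclideanSpace_fin, show π / (1 / 2) = 2 * π by ring,
    ← Real.rpow_add (by positivity)]
  rw [show -(d : ℝ) / 2 + d / 2 = 0 by ring, Real.rpow_zero]

theorem integrable_one_add_norm_pow_mul_gaussDensity (d N : ℕ) :
    Integrable (fun z : EuclideanSpace ℝ (Fin d) => (1 + ‖z‖) ^ N * gaussDensity d 1 z) := by
  refine ((integrable_exp_neg_mul_norm_sq (V := EuclideanSpace ℝ (Fin d))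
    (b := 1 / 4) (by norm_num)).const_mul
      ((N.factorial : ℝ) * Real.exp 2 * (2 * π) ^ (-(d : ℝ) / 2))).mono' ?_ ?_
  · exact (Continuous.mul (by fun_prop) (continuous_gaussDensity d 1)).aestronglyMeasurable
  · refine Filter.Eventually.of_forall fun z => ?_
    rw [Real.norm_of_nonneg (mul_nonneg (by positivity) (gaussDensity_nonneg d 1 z)),
      gaussDensity_one_eq]
    have h1 : (1 + ‖z‖) ^ N ≤ N.factorial * Real.exp (1 + ‖z‖) := by
      have := Real.pow_div_factorial_le_exp (1 + ‖z‖) (by positivity) N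
      rw [div_le_iff₀ (by positivity)] at this
      linarith
    have h2 : Real.exp (1 + ‖z‖) * Real.exp (-(1 / 2) * ‖z‖ ^ 2)
        ≤ Real.exp 2 * Real.exp (-(1 / 4) * ‖z‖ ^ 2) := by
      rw [← Real.exp_add, ← Real.exp_add]
      refine Real.exp_le_exp.mpr ?_
      nlinarith [sq_nonneg (‖z‖ - 2)]
    calc (1 + ‖z‖) ^ N * ((2 * π) ^ (-(d : ℝ) / 2) * Real.exp (-(1 / 2) * ‖z‖ ^ 2))
        ≤ (N.factorial * Real.exp (1 + ‖z‖)) *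
          ((2 * π) ^ (-(d : ℝ) / 2) * Real.exp (-(1 / 2) * ‖z‖ ^ 2)) := by gcongr
      _ = N.factorial * (2 * π) ^ (-(d : ℝ) / 2) *
          (Real.exp (1 + ‖z‖) * Real.exp (-(1 / 2) * ‖z‖ ^ 2)) := by ring
      _ ≤ N.factorial * (2 * π) ^ (-(d : ℝ) / 2) *
          (Real.exp 2 * Real.exp (-(1 / 4) * ‖z‖ ^ 2)) := by gcongr
      _ = _ := by ring

theorem integrable_gaussDensity_one (d : ℕ) : Integrable (gaussDensity d 1) := by
  simpa using integrable_one_add_norm_pow_mul_gaussDensity d 0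

theorem gaussDensity_smul {d : ℕ} {σ : ℝ} (hσ : 0 < σ) (z : EuclideanSpace ℝ (Fin d)) :
    gaussDensity d 1 z = σ ^ d * gaussDensity d σ (σ • z) := by
  unfold gaussDensity
  have h1 : (2 * π * σ ^ 2) ^ (-(d : ℝ) / 2) = (2 * π) ^ (-(d : ℝ) / 2) * (σ ^ d)⁻¹ := by
    rw [Real.mul_rpow (by positivity) (by positivity), ← Real.rpow_natCast σ 2,
      ← Real.rpow_mul hσ.le, ← Real.rpow_natCast σ d, ← Real.rpow_neg hσ.le]
    congr 2
    push_cast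
    ring
  have h2 : -‖σ • z‖ ^ 2 / (2 * σ ^ 2) = -‖z‖ ^ 2 / (2 * 1 ^ 2) := by
    rw [norm_smul, Real.norm_of_nonneg hσ.le]
    field_simp
  rw [h1, h2]
  field_simp

/-- Expectations under `N(0, σ²I)` are expectations of the rescaled function under `N(0, I)`. -/
theorem integral_gaussDensity_smul {d : ℕ} {F : Type*} [NormedAddCommGroup F] [NormedSpace ℝ F]
    {σ : ℝ} (hσ : 0 < σ) (f : EuclideanSpace ℝ (Fin d) → F) :
    ∫ y, gaussDensity d σ y • f y = ∫ z, gaussDensity d 1 z • f (σ • z) := by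
  have h := Measure.integral_comp_smul (volume : Measure (EuclideanSpace ℝ (Fin d)))
    (fun y => gaussDensity d σ y • f y) σ
  rw [finrank_euclideanSpace_fin, abs_of_pos (by positivity)] at h
  simp_rw [gaussDensity_smul hσ, mul_smul]
  rw [integral_smul, h, smul_smul, mul_inv_cancel₀ (by positivity), one_smul]

/-- The expectation under `N(0, I)` of a bounded continuous function of `x - σ z` is jointly
continuous in `(σ, x)`, including at `σ = 0`. -/
theorem continuous_integral_gaussDensity_smul_sub {d : ℕ} {F : Type*} [NormedAddCommGroup F]
    [NormedSpace ℝ F] {f : EuclideanSpace ℝ (Fin d) → F} (hf : Continuous f) {M : ℝ}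
    (hM : ∀ x, ‖f x‖ ≤ M) :
    Continuous fun a : ℝ × EuclideanSpace ℝ (Fin d) =>
      ∫ z, gaussDensity d 1 z • f (a.2 - a.1 • z) := by
  have hg := continuous_gaussDensity d 1
  refine continuous_of_dominated (bound := fun z => gaussDensity d 1 z * M) ?_ ?_ ?_ ?_
  · intro a
    exact Continuous.aestronglyMeasurable (by fun_prop)
  · refine fun a => Filter.Eventually.of_forall fun z => ?_
    rw [norm_smul, Real.norm_of_nonneg (gaussDensity_nonneg d 1 z)]
    exact mul_le_mul_of_nonneg_left (hM _) (gaussDensity_nonneg d 1 z)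
  · exact (integrable_gaussDensity_one d).mul_const M
  · exact Filter.Eventually.of_forall fun z => by fun_prop

theorem hasFDerivAt_integral_gaussDensity_smul_sub {d : ℕ} {p : EuclideanSpace ℝ (Fin d) → ℝ}
    (hp : ContDiff ℝ 1 p) {M : ℝ} (hM : ∀ x, ‖p x‖ ≤ M) (hM' : ∀ x, ‖fderiv ℝ p x‖ ≤ M)
    (σ : ℝ) (x : EuclideanSpace ℝ (Fin d)) :
    HasFDerivAt (fun x => ∫ z, gaussDensity d 1 z • p (x - σ • z))
      (∫ z, gaussDensity d 1 z • fderiv ℝ p (x - σ • z)) x := by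
  have hg := continuous_gaussDensity d 1
  have hpc := hp.continuous
  have hp' := hp.continuous_fderiv one_ne_zero
  refine hasFDerivAt_integral_of_dominated_of_fderiv_le (𝕜 := ℝ) (s := Set.univ)
    (F' := fun x z => gaussDensity d 1 z • fderiv ℝ p (x - σ • z))
    (bound := fun z => gaussDensity d 1 z * M) Filter.univ_mem ?_ ?_ ?_ ?_ ?_ ?_
  · exact Filter.Eventually.of_forall fun x => Continuous.aestronglyMeasurable (by fun_prop)
  · refine ((integrable_gaussDensity_one d).mul_const M).mono'
      (Continuous.aestronglyMeasurable (by fun_prop)) (Filter.Eventually.of_forall fun z => ?_)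
    rw [norm_smul, Real.norm_of_nonneg (gaussDensity_nonneg d 1 z)]
    exact mul_le_mul_of_nonneg_left (hM _) (gaussDensity_nonneg d 1 z)
  · exact Continuous.aestronglyMeasurable (by fun_prop)
  · refine Filter.Eventually.of_forall fun z x _ => ?_
    rw [norm_smul, Real.norm_of_nonneg (gaussDensity_nonneg d 1 z)]
    exact mul_le_mul_of_nonneg_left (hM' _) (gaussDensity_nonneg d 1 z)
  · exact (integrable_gaussDensity_one d).mul_const M
  · refine Filter.Eventually.of_forall fun z x _ => ?_
    have h := ((hp.differentiable one_ne_zero) (x - σ • z)).hasFDerivAt.comp x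
      ((hasFDerivAt_id x).sub_const (σ • z))
    exact h.const_smul (gaussDensity d 1 z)

theorem integral_gaussDensity_smul_sub_pos {d : ℕ} {p : EuclideanSpace ℝ (Fin d) → ℝ}
    (hp : Continuous p) (hpos : ∀ x, 0 < p x) {M : ℝ} (hM : ∀ x, ‖p x‖ ≤ M)
    (σ : ℝ) (x : EuclideanSpace ℝ (Fin d)) :
    0 < ∫ z, gaussDensity d 1 z • p (x - σ • z) := by
  have hg := continuous_gaussDensity d 1
  have hgpos : ∀ z, 0 < gaussDensity d 1 z • p (x - σ • z) := fun z => by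
    have : 0 < gaussDensity d 1 z := by
      unfold gaussDensity
      positivity
    exact mul_pos this (hpos _)
  rw [integral_pos_iff_support_of_nonneg (fun z => (hgpos z).le)]
  · rw [Function.support_eq_univ fun z => (hgpos z).ne']
    exact Measure.measure_univ_pos.mpr (NeZero.ne _)
  · refine ((integrable_gaussDensity_one d).mul_const M).mono'
      (Continuous.aestronglyMeasurable (by fun_prop)) (Filter.Eventually.of_forall fun z => ?_)
    rw [norm_smul, Real.norm_of_nonneg (gaussDensity_nonneg d 1 z)]
    exact mul_le_mul_of_nonneg_left (hM _) (gaussDensity_nonneg d 1 z)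

/-- A score field `S`, jointly continuous in the noise level and the point, whose growth is at most
polynomial in the point and in the inverse noise level, has Gaussian averages which are jointly
continuous on `[0, σm] × K`. -/
theorem continuousOn_integral_gaussDensity_smul_add {d : ℕ} {F : Type*} [NormedAddCommGroup F]
    [NormedSpace ℝ F] {S : ℝ × EuclideanSpace ℝ (Fin d) → F} (hS : Continuous S)
    {B β σm : ℝ} {r : ℕ} (hB : 0 ≤ B) (hσm : σm ≤ 1)
    (hbound : ∀ σ, 0 < σ → σ ≤ σm → ∀ x, ‖S (σ, x)‖ ≤ B * σ ^ β * (1 + ‖x‖ ^ r))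
    {K : Set (EuclideanSpace ℝ (Fin d))} (hK : IsCompact K) :
    ContinuousOn (fun a : ℝ × EuclideanSpace ℝ (Fin d) =>
      ∫ z, gaussDensity d 1 z • S (a.1, a.2 + a.1 • z)) (Set.Icc 0 σm ×ˢ K) := by
  have hg := continuous_gaussDensity d 1
  obtain ⟨R, hR0, hR⟩ := hK.isBounded.exists_pos_norm_le
  obtain ⟨C, hC⟩ := (((isCompact_Icc (a := (0 : ℝ)) (b := σm)).prod
    (isCompact_closedBall (0 : EuclideanSpace ℝ (Fin d)) (R + 1))).exists_bound_of_continuousOn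
      hS.continuousOn)
  obtain ⟨n, hn⟩ := exists_nat_ge (-β)
  have hnear : ∀ a ∈ Set.Icc 0 σm ×ˢ K, ∀ z, ‖a.1 • z‖ ≤ 1 → ‖S (a.1, a.2 + a.1 • z)‖ ≤ C := by
    rintro ⟨σ, x⟩ ⟨hσ, hx⟩ z hz
    refine hC _ ⟨hσ, ?_⟩
    rw [mem_closedBall_zero_iff]
    exact (norm_add_le _ _).trans (add_le_add (hR x hx) hz)
  have hfar : ∀ a ∈ Set.Icc 0 σm ×ˢ K, ∀ z, 1 < ‖a.1 • z‖ →
      ‖S (a.1, a.2 + a.1 • z)‖ ≤ B * (2 * (1 + R) ^ r) * (1 + ‖z‖) ^ (n + r) := by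
    rintro ⟨σ, x⟩ ⟨⟨hσ0, hσ⟩, hx⟩ z hz
    simp only at hσ0 hσ hx hz ⊢
    have hσpos : 0 < σ := hσ0.lt_of_ne (by rintro rfl; norm_num at hz)
    have hσ1 : σ ≤ 1 := hσ.trans hσm
    rw [norm_smul, Real.norm_of_nonneg hσ0] at hz
    have h1 : σ ^ β ≤ (1 + ‖z‖) ^ n := by
      calc σ ^ β = σ ^ β * 1 := (mul_one _).symm
        _ ≤ σ ^ β * (σ * ‖z‖) ^ n := by
          gcongr
          exact one_le_pow₀ hz.le
        _ = σ ^ (β + n) * ‖z‖ ^ n := by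
          rw [mul_pow, Real.rpow_add hσpos, Real.rpow_natCast]
          ring
        _ ≤ 1 * (1 + ‖z‖) ^ n := by
          gcongr
          · exact Real.rpow_le_one hσ0 hσ1 (by linarith)
          · linarith
        _ = _ := one_mul _
    have h2 : ‖x + σ • z‖ ≤ (1 + R) * (1 + ‖z‖) := by
      have := norm_add_le x (σ • z)
      rw [norm_smul, Real.norm_of_nonneg hσ0] at this
      have hx' := hR x hx
      have hz' : σ * ‖z‖ ≤ ‖z‖ := mul_le_of_le_one_left (norm_nonneg z) hσ1
      nlinarith [mul_nonneg hR0.le (norm_nonneg z)]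
    have h3 : 1 + ‖x + σ • z‖ ^ r ≤ 2 * (1 + R) ^ r * (1 + ‖z‖) ^ r := by
      have h4 : ‖x + σ • z‖ ^ r ≤ ((1 + R) * (1 + ‖z‖)) ^ r := by gcongr
      have h5 : 1 ≤ ((1 + R) * (1 + ‖z‖)) ^ r :=
        one_le_pow₀ (by nlinarith [mul_nonneg hR0.le (norm_nonneg z), norm_nonneg z])
      rw [mul_pow] at h4 h5
      linarith
    calc ‖S (σ, x + σ • z)‖ ≤ B * σ ^ β * (1 + ‖x + σ • z‖ ^ r) := hbound σ hσpos hσ _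
      _ ≤ B * (1 + ‖z‖) ^ n * (2 * (1 + R) ^ r * (1 + ‖z‖) ^ r) := by gcongr
      _ = _ := by rw [pow_add]; ring
  have hall : ∀ a ∈ Set.Icc 0 σm ×ˢ K, ∀ z, ‖S (a.1, a.2 + a.1 • z)‖ ≤
      |C| + B * (2 * (1 + R) ^ r) * (1 + ‖z‖) ^ (n + r) := by
    intro a ha z
    rcases le_or_gt ‖a.1 • z‖ 1 with hz | hz
    · have : 0 ≤ B * (2 * (1 + R) ^ r) * (1 + ‖z‖) ^ (n + r) := by positivity
      linarith [hnear a ha z hz, le_abs_self C]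
    · linarith [hfar a ha z hz, abs_nonneg C]
  refine continuousOn_of_dominated (bound := fun z => gaussDensity d 1 z * |C| +
    B * (2 * (1 + R) ^ r) * ((1 + ‖z‖) ^ (n + r) * gaussDensity d 1 z)) ?_ ?_ ?_ ?_
  · exact fun a _ => Continuous.aestronglyMeasurable (by fun_prop)
  · refine fun a ha => Filter.Eventually.of_forall fun z => ?_
    rw [norm_smul, Real.norm_of_nonneg (gaussDensity_nonneg d 1 z)]
    refine (mul_le_mul_of_nonneg_left (hall a ha z) (gaussDensity_nonneg d 1 z)).trans_eq ?_
    ring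
  · exact ((integrable_gaussDensity_one d).mul_const _).add
      ((integrable_one_add_norm_pow_mul_gaussDensity d (n + r)).const_mul _)
  · exact Filter.Eventually.of_forall fun z => Continuous.continuousOn (by fun_prop)

/-- Under regularity and sub-polynomial score assumptions, the SNORE score
`∇R_σ(x) = -E_{ζ ~ N(0,σ²I)}[∇ log p_σ(x + ζ)]` converges uniformly to
`-∇ log p` on every compact as `σ → 0`. -/
theorem stmt8 {d : ℕ} (p : EuclideanSpace ℝ (Fin d) → ℝ)
    (hp : ContDiff ℝ 1 p) (hpos : ∀ x, 0 < p x)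
    (M : ℝ) (hboundp : ∀ x, p x + ‖gradient p x‖ ≤ M)
    (A : ℝ) (q : ℕ) (hA : 0 ≤ A)
    (hscore : ∀ x, ‖gradient (fun z => Real.log (p z)) x‖ ≤ A * (1 + ‖x‖ ^ q))
    (pσ : ℝ → EuclideanSpace ℝ (Fin d) → ℝ)
    (hpσ : ∀ σ, 0 < σ → ∀ x, pσ σ x = ∫ y, p (x - y) * gaussDensity d σ y)
    (B β : ℝ) (r : ℕ) (hB : 0 ≤ B) (σ₀ : ℝ) (hσ₀ : 0 < σ₀)
    (hnoisyscore : ∀ σ, 0 < σ → σ ≤ σ₀ → ∀ x,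
      ‖gradient (fun z => Real.log (pσ σ z)) x‖ ≤ B * σ ^ β * (1 + ‖x‖ ^ r))
    (gradR : ℝ → EuclideanSpace ℝ (Fin d) → EuclideanSpace ℝ (Fin d))
    (hgradR : ∀ σ, 0 < σ → ∀ x, gradR σ x =
      -∫ ζ, gaussDensity d σ ζ • gradient (fun z => Real.log (pσ σ z)) (x + ζ)) :
    ∀ K : Set (EuclideanSpace ℝ (Fin d)), IsCompact K →
      ∀ ε > 0, ∃ σ₁ > 0, ∀ σ, 0 < σ → σ ≤ σ₁ → ∀ x ∈ K,
        ‖gradR σ x + gradient (fun z => Real.log (p z)) x‖ ≤ ε := by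
  intro K hK ε hε
  have hpM : ∀ x, ‖p x‖ ≤ M := fun x => by
    rw [Real.norm_of_nonneg (hpos x).le]
    linarith [hboundp x, norm_nonneg (gradient p x)]
  have hpM' : ∀ x, ‖fderiv ℝ p x‖ ≤ M := fun x => by
    have h : ‖gradient p x‖ = ‖fderiv ℝ p x‖ := LinearIsometryEquiv.norm_map _ _
    linarith [hboundp x, hpos x]
  have hpc := hp.continuous
  set P : ℝ × EuclideanSpace ℝ (Fin d) → ℝ :=
    fun a => ∫ z, gaussDensity d 1 z • p (a.2 - a.1 • z) with hP
  set G : ℝ × EuclideanSpace ℝ (Fin d) → StrongDual ℝ (EuclideanSpace ℝ (Fin d)) :=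
    fun a => ∫ z, gaussDensity d 1 z • fderiv ℝ p (a.2 - a.1 • z)
  set S : ℝ × EuclideanSpace ℝ (Fin d) → EuclideanSpace ℝ (Fin d) :=
    fun a => (InnerProductSpace.toDual ℝ _).symm ((P a)⁻¹ • G a)
  have hPpos : ∀ a, 0 < P a := fun a =>
    integral_gaussDensity_smul_sub_pos hpc hpos hpM a.1 a.2
  have hPcont : Continuous P := continuous_integral_gaussDensity_smul_sub hpc hpM
  have hGcont : Continuous G :=
    continuous_integral_gaussDensity_smul_sub (hp.continuous_fderiv one_ne_zero) hpM'
  have hS : Continuous S :=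
    (LinearIsometryEquiv.continuous _).comp ((hPcont.inv₀ fun a => (hPpos a).ne').smul hGcont)
  have hgrad : ∀ σ x, gradient (fun z => Real.log (P (σ, z))) x = S (σ, x) := fun σ x => by
    have h := (hasFDerivAt_integral_gaussDensity_smul_sub hp hpM hpM' σ x).log
      (hPpos (σ, x)).ne'
    unfold gradient
    rw [h.fderiv]
  have hpσP : ∀ σ, 0 < σ → pσ σ = fun x => P (σ, x) := fun σ hσ => by
    funext x
    rw [hpσ σ hσ x, hP]
    simp_rw [mul_comm (p _)]
    exact integral_gaussDensity_smul hσ fun y => p (x - y)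
  have hP0 : (fun x => P (0, x)) = p := by
    funext x
    simp [hP, integral_mul_const, integral_gaussDensity_one]
  have hS0 : ∀ x, gradient (fun z => Real.log (p z)) x = S (0, x) := fun x => by
    rw [← hgrad 0 x, ← hP0]
  have hSσ : ∀ σ, 0 < σ → ∀ x, gradient (fun z => Real.log (pσ σ z)) x = S (σ, x) :=
    fun σ hσ x => by rw [← hgrad σ x, hpσP σ hσ]
  have hσm : 0 < min σ₀ 1 := lt_min hσ₀ one_pos
  have hT := continuousOn_integral_gaussDensity_smul_add hS hB (min_le_right σ₀ 1)
    (fun σ hσ hσ' x => by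
      rw [← hSσ σ hσ x]
      exact hnoisyscore σ hσ (hσ'.trans (min_le_left _ _)) x) hK
  have hunif := (isCompact_Icc.prod hK).uniformContinuousOn_of_continuous hT
  obtain ⟨δ, hδ, hclose⟩ := Metric.uniformContinuousOn_iff.mp hunif ε hε
  refine ⟨min (min σ₀ 1) (δ / 2), lt_min hσm (half_pos hδ), fun σ hσ hσ₁ x hx => ?_⟩
  have h := hclose (σ, x) ⟨⟨hσ.le, hσ₁.trans (min_le_left _ _)⟩, hx⟩
    (0, x) ⟨⟨le_rfl, hσm.le⟩, hx⟩ (by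
      have := hσ₁.trans (min_le_right _ _)
      simp only [Prod.dist_eq, dist_self, Real.dist_eq, sub_zero, abs_of_pos hσ]
      exact max_lt (by linarith) hδ)
  have hlim : ∫ z, gaussDensity d 1 z • S (0, x + (0 : ℝ) • z) = S (0, x) := by
    simp [integral_smul_const, integral_gaussDensity_one]
  have hR : gradR σ x = -∫ z, gaussDensity d 1 z • S (σ, x + σ • z) := by
    rw [hgradR σ hσ x]
    simp_rw [hSσ σ hσ]
    rw [integral_gaussDensity_smul hσ fun ζ => S (σ, x + ζ)]
  rw [hS0, hR, neg_add_eq_sub, norm_sub_rev, ← dist_eq_norm]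
  simp only [hlim] at h
  exact h.le
end
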